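/- arXiv:1507.01505 — 2 statements merged into one kernel-verified Lean document; each statement's English description precedes it below -/
import Mathlib

section
/- If W is a doubling 2π-periodic weight function with doubling constant L, then for every real x, y and every δ > 0: ∫_{y-δ}^{y+δ} W(θ)dθ ≤ L·(1 + |x-y|/δ)^{log₂ L} · ∫_{x-δ}^{x+δ} W(θ)dθ. -/
open MeasureTheory Real Set

noncomputable section

/-- A `2π`-periodic weight function. -/
def IsPeriodicWeight (W : ℝ → ℝ) : Prop :=
  Measurable W ∧ (∀ θ, 0 ≤ W θ) ∧ Function.Periodic W (2 * π) ∧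
  IntervalIntegrable W volume (-π) π ∧ 0 < ∫ θ in (-π)..π, W θ

/-- `W` is doubling with doubling constant `L` (periodic setting). -/
def IsDoublingPeriodic (W : ℝ → ℝ) (L : ℝ) : Prop :=
  ∀ δ : ℝ, 0 < δ → ∀ a : ℝ,
    (∫ θ in (a - 2*δ)..(a + 2*δ), W θ) ≤ L * ∫ θ in (a - δ)..(a + δ), W θ

theorem IsPeriodicWeight.intervalIntegrable {W : ℝ → ℝ} (hW : IsPeriodicWeight W) (a b : ℝ) :
    IntervalIntegrable W volume a b := by
  obtain ⟨-, -, hper, hint, -⟩ := hW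
  refine hper.intervalIntegrable two_pi_pos.ne' (t := -π) ?_ a b
  rwa [show -π + 2 * π = π by ring]

theorem IsPeriodicWeight.integral_mono {W : ℝ → ℝ} (hW : IsPeriodicWeight W) {a b c d : ℝ}
    (hca : c ≤ a) (hab : a ≤ b) (hbd : b ≤ d) :
    (∫ θ in a..b, W θ) ≤ ∫ θ in c..d, W θ :=
  intervalIntegral.integral_mono_interval hca hab hbd
    (Filter.Eventually.of_forall hW.2.1) (hW.intervalIntegrable c d)

theorem IsDoublingPeriodic.one_le {W : ℝ → ℝ} {L : ℝ} (hd : IsDoublingPeriodic W L)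
    (hW : IsPeriodicWeight W) : 1 ≤ L := by
  have h := hd π pi_pos 0
  have hmono : (∫ θ in (-π)..π, W θ) ≤ ∫ θ in (0 - 2 * π)..(0 + 2 * π), W θ :=
    hW.integral_mono (by linarith [pi_pos]) (by linarith [pi_pos]) (by linarith [pi_pos])
  rw [zero_sub π, zero_add π] at h
  exact (le_mul_iff_one_le_left hW.2.2.2.2).1 (hmono.trans h)

theorem IsDoublingPeriodic.integral_two_pow_le {W : ℝ → ℝ} {L : ℝ}
    (hd : IsDoublingPeriodic W L) (hL : 0 ≤ L) {δ : ℝ} (hδ : 0 < δ) (a : ℝ) (n : ℕ) :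
    (∫ θ in (a - 2 ^ n * δ)..(a + 2 ^ n * δ), W θ) ≤
      L ^ n * ∫ θ in (a - δ)..(a + δ), W θ := by
  induction n with
  | zero => simp
  | succ n ih =>
    rw [pow_succ' (2 : ℝ), pow_succ' L, mul_assoc, mul_assoc]
    exact (hd _ (by positivity) a).trans (mul_le_mul_of_nonneg_left ih hL)

theorem doubling_translate (W : ℝ → ℝ) (L : ℝ) (hL : 0 < L)
    (hW : IsPeriodicWeight W) (hd : IsDoublingPeriodic W L)
    (x y : ℝ) (δ : ℝ) (hδ : 0 < δ) :
    (∫ θ in (y - δ)..(y + δ), W θ) ≤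
      L * (1 + |x - y| / δ) ^ (Real.logb 2 L) * ∫ θ in (x - δ)..(x + δ), W θ := by
  have hL1 : 1 ≤ L := hd.one_le hW
  have ht : 1 ≤ 1 + |x - y| / δ := le_add_of_nonneg_right (by positivity)
  obtain ⟨n, hn, hn'⟩ := exists_nat_pow_near ht one_lt_two
  have hR : |x - y| + δ ≤ 2 ^ (n + 1) * δ := by
    calc |x - y| + δ = (1 + |x - y| / δ) * δ := by field_simp; ring
      _ ≤ 2 ^ (n + 1) * δ := by gcongr
  have hpow : L ^ n ≤ (1 + |x - y| / δ) ^ Real.logb 2 L := by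
    calc L ^ n = ((2 : ℝ) ^ Real.logb 2 L) ^ n := by
          rw [Real.rpow_logb two_pos (by norm_num) hL]
      _ = ((2 : ℝ) ^ n) ^ Real.logb 2 L := Real.rpow_pow_comm two_pos.le _ _
      _ ≤ _ := Real.rpow_le_rpow (by positivity) hn (Real.logb_nonneg one_lt_two hL1)
  have hnonneg : 0 ≤ ∫ θ in (x - δ)..(x + δ), W θ :=
    intervalIntegral.integral_nonneg (by linarith) fun θ _ => hW.2.1 θ
  obtain ⟨h₁, h₂⟩ := abs_le.1 (le_refl |x - y|)
  calc (∫ θ in (y - δ)..(y + δ), W θ)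
      ≤ ∫ θ in (x - 2 ^ (n + 1) * δ)..(x + 2 ^ (n + 1) * δ), W θ :=
        hW.integral_mono (by linarith) (by linarith) (by linarith)
    _ ≤ L ^ (n + 1) * ∫ θ in (x - δ)..(x + δ), W θ := hd.integral_two_pow_le hL.le hδ x (n + 1)
    _ ≤ L * (1 + |x - y| / δ) ^ Real.logb 2 L * ∫ θ in (x - δ)..(x + δ), W θ := by
        rw [pow_succ' L]
        gcongr
end
end

section
/- For every integer m ≥ 1 and every θ ∈ [-π, π] with |θ| ≥ π/(2m+1): F_m(θ) ≤ F_m(π/(2m+1)). Consequently, the trigonometric polynomial p(θ) := F_m(θ)^ℓ · (F_m(θ) - F_m(π/(2m+1))) is nonpositive on [-π, π] \ (-π/(2m+1), π/(2m+1)) for every integer ℓ ≥ 0. -/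
open Real Set

noncomputable section

/-- Variant of the Fejér kernel: `F_m(θ) = (sin((2m+1)θ/2)/((2m+1)sin(θ/2)))²` away from
multiples of `2π` (where `sin(θ/2) = 0`), and `1` at multiples of `2π`. -/
def Fm (m : ℕ) (θ : ℝ) : ℝ :=
  if Real.sin (θ / 2) = 0 then 1
  else (Real.sin ((2 * m + 1) * θ / 2) / ((2 * m + 1) * Real.sin (θ / 2))) ^ 2

theorem Fm_nonneg (m : ℕ) (θ : ℝ) : 0 ≤ Fm m θ := by
  unfold Fm
  split_ifs <;> positivity

theorem Fm_neg (m : ℕ) (θ : ℝ) : Fm m (-θ) = Fm m θ := by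
  simp [Fm, neg_div, div_neg]

theorem Fm_abs (m : ℕ) (θ : ℝ) : Fm m |θ| = Fm m θ := by
  rcases abs_choice θ with h | h <;> rw [h]
  exact Fm_neg m θ

theorem Fm_pi_div (m : ℕ) :
    Fm m (π / (2 * m + 1)) = 1 / ((2 * m + 1) * sin (π / (2 * m + 1) / 2)) ^ 2 := by
  have hn : (0 : ℝ) < 2 * m + 1 := by positivity
  have hle : π / (2 * m + 1) ≤ π := div_le_self pi_pos.le (by linarith)
  have hsin : 0 < sin (π / (2 * m + 1) / 2) :=
    sin_pos_of_pos_of_lt_pi (by positivity) (by linarith [pi_pos])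
  rw [Fm, if_neg hsin.ne', mul_div_cancel₀ π hn.ne', sin_pi_div_two, div_pow, one_pow]

theorem Fm_le_of_pi_div_le (m : ℕ) {θ : ℝ} (h : π / (2 * m + 1) ≤ θ) (hθ : θ ≤ π) :
    Fm m θ ≤ Fm m (π / (2 * m + 1)) := by
  have hpos : 0 < π / (2 * m + 1) := by positivity
  have hsin : 0 < sin (π / (2 * m + 1) / 2) :=
    sin_pos_of_pos_of_lt_pi (by positivity) (by linarith)
  have hmono : sin (π / (2 * m + 1) / 2) ≤ sin (θ / 2) :=
    sin_le_sin_of_le_of_le_pi_div_two (by linarith) (by linarith) (by linarith)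
  rw [Fm_pi_div, Fm, if_neg (hsin.trans_le hmono).ne', div_pow]
  gcongr
  exact sin_sq_le_one _

theorem fejer_max_outside (m : ℕ) (hm : 1 ≤ m) :
    (∀ θ ∈ Icc (-π) π, π / (2 * m + 1) ≤ |θ| → Fm m θ ≤ Fm m (π / (2 * m + 1))) ∧
    ∀ ℓ : ℕ, ∀ θ ∈ Icc (-π) π \ Ioo (-(π / (2 * m + 1))) (π / (2 * m + 1)),
      (Fm m θ) ^ ℓ * (Fm m θ - Fm m (π / (2 * m + 1))) ≤ 0 := by
  have outside : ∀ θ ∈ Icc (-π) π, π / (2 * m + 1) ≤ |θ| →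
      Fm m θ ≤ Fm m (π / (2 * m + 1)) := fun θ hθ h => by
    rw [← Fm_abs m θ]
    exact Fm_le_of_pi_div_le m h (abs_le.mpr hθ)
  refine ⟨outside, fun ℓ θ hθ => ?_⟩
  refine mul_nonpos_of_nonneg_of_nonpos (pow_nonneg (Fm_nonneg m θ) ℓ) ?_
  refine sub_nonpos.mpr (outside θ hθ.1 ?_)
  exact not_lt.mp fun h => hθ.2 (abs_lt.mp h)
end
end
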